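/- Number of massless modes: for every bipartite graph G with parts Fin n and Fin n and edge set E, the dimension of the kernel of the linear map x ↦ A_G · x defined by the generic edge matrix A_G over the fraction field K equals n − ν(G). -/

import Mathlib

/-- `M` is a matching of the bipartite graph with edge set `E`: a subset of `E` in which
no two edges share a left vertex or a right vertex. -/
def IsMatching {L R : Type*} (E M : Finset (L × R)) : Prop :=
  M ⊆ E ∧ (∀ e ∈ M, ∀ e' ∈ M, e.1 = e'.1 → e = e') ∧
    (∀ e ∈ M, ∀ e' ∈ M, e.2 = e'.2 → e = e')

/-- `ν(G)`: the maximum cardinality of a matching of the bipartite graph with edge set `E`. -/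
noncomputable def matchNum {L R : Type*} (E : Finset (L × R)) : ℕ :=
  sSup {k : ℕ | ∃ M : Finset (L × R), IsMatching E M ∧ M.card = k}

/-- The fraction field `K` of the multivariate polynomial ring over `ℚ` with one
indeterminate `X_e` for each edge `e ∈ E`. -/
abbrev EdgeField {m n : ℕ} (E : Finset (Fin m × Fin n)) : Type :=
  FractionRing (MvPolynomial {e : Fin m × Fin n // e ∈ E} ℚ)

/-- The generic edge matrix `A_G` of the bipartite graph with edge set `E`: the `(i, j)`
entry is the indeterminate `X_{(i,j)}` if `(i, j) ∈ E`, and `0` otherwise. -/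
noncomputable def genMat {m n : ℕ} (E : Finset (Fin m × Fin n)) :
    Matrix (Fin m) (Fin n) (EdgeField E) :=
  Matrix.of fun i j =>
    if h : (i, j) ∈ E then
      algebraMap (MvPolynomial {e : Fin m × Fin n // e ∈ E} ℚ) (EdgeField E)
        (MvPolynomial.X ⟨(i, j), h⟩)
    else 0

open scoped Matrix

/-- A matrix of rank `r` over a field has `r` linearly independent rows. -/
theorem Matrix.exists_linearIndependent_row {m n F : Type*} [Field F] [Finite m] [Fintype n]
    (A : Matrix m n F) {r : ℕ} (hr : A.rank = r) :
    ∃ f : Fin r → m, Function.Injective f ∧ LinearIndependent F (A.submatrix f id).row := by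
  cases nonempty_fintype m
  obtain ⟨κ, a, ha, hspan, hli⟩ := exists_linearIndependent' F A.row
  have := Finite.of_injective a ha
  cases nonempty_fintype κ
  have hcard : Fintype.card κ = r := by
    rw [← finrank_span_eq_card hli, hspan, ← A.rank_eq_finrank_span_row, hr]
  let e := (Fintype.equivFinOfCardEq hcard).symm
  exact ⟨a ∘ e, ha.comp e.injective, hli.comp e e.injective⟩

/-- A matrix of rank `r` over a field has a nonzero minor of size `r`. -/
theorem Matrix.exists_submatrix_det_ne_zero {m n F : Type*} [Field F] [Finite m] [Fintype n]
    (A : Matrix m n F) {r : ℕ} (hr : A.rank = r) :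
    ∃ (f : Fin r → m) (g : Fin r → n), Function.Injective f ∧ Function.Injective g ∧
      (A.submatrix f g).det ≠ 0 := by
  obtain ⟨f, hf, hrow⟩ := A.exists_linearIndependent_row hr
  have hr' : (A.submatrix f id)ᵀ.rank = r := by
    rw [Matrix.rank_transpose, hrow.rank_matrix, Fintype.card_fin]
  obtain ⟨g, hg, hcol⟩ := (A.submatrix f id)ᵀ.exists_linearIndependent_row hr'
  refine ⟨f, g, hf, hg, ?_⟩
  rw [← Matrix.det_transpose]
  have hunit := Matrix.linearIndependent_rows_iff_isUnit.mp hcol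
  exact ((Matrix.isUnit_iff_isUnit_det _).mp hunit).ne_zero

/-- A matrix of rank `r` over a field has `r` nonzero entries in distinct rows and columns. -/
theorem Matrix.exists_transversal_ne_zero {m n F : Type*} [Field F] [Finite m] [Fintype n]
    (A : Matrix m n F) {r : ℕ} (hr : A.rank = r) :
    ∃ (f : Fin r → m) (g : Fin r → n), Function.Injective f ∧ Function.Injective g ∧
      ∀ i, A (f i) (g i) ≠ 0 := by
  obtain ⟨f, g, hf, hg, hdet⟩ := A.exists_submatrix_det_ne_zero hr
  rw [Matrix.det_apply] at hdet
  obtain ⟨σ, -, hσ⟩ := Finset.exists_ne_zero_of_sum_ne_zero hdet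
  refine ⟨f ∘ σ, g, hf.comp σ.injective, hg, fun i hi => hσ ?_⟩
  rw [Finset.prod_eq_zero (Finset.mem_univ i) hi, smul_zero]

theorem bddAbove_matching_card {L R : Type*} (E : Finset (L × R)) :
    BddAbove {k : ℕ | ∃ M : Finset (L × R), IsMatching E M ∧ M.card = k} :=
  ⟨E.card, by rintro _ ⟨M, hM, rfl⟩; exact Finset.card_le_card hM.1⟩

theorem IsMatching.card_le_matchNum {L R : Type*} {E M : Finset (L × R)} (hM : IsMatching E M) :
    M.card ≤ matchNum E :=
  le_csSup (bddAbove_matching_card E) ⟨M, hM, rfl⟩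

theorem exists_isMatching_card_eq_matchNum {L R : Type*} (E : Finset (L × R)) :
    ∃ M : Finset (L × R), IsMatching E M ∧ M.card = matchNum E :=
  Nat.sSup_mem (s := {k : ℕ | ∃ M : Finset (L × R), IsMatching E M ∧ M.card = k})
    ⟨0, ∅, by simp [IsMatching], rfl⟩ (bddAbove_matching_card E)

theorem rank_genMat_le_matchNum {m n : ℕ} (E : Finset (Fin m × Fin n)) :
    (genMat E).rank ≤ matchNum E := by
  obtain ⟨f, g, hf, hg, hne⟩ := (genMat E).exists_transversal_ne_zero rfl
  have hE (i) : (f i, g i) ∈ E := by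
    by_contra hi
    exact hne i (dif_neg hi)
  let φ : Fin (genMat E).rank ↪ Fin m × Fin n :=
    ⟨fun i => (f i, g i), fun i j hij => hg (Prod.ext_iff.mp hij).2⟩
  have hM : IsMatching E (Finset.univ.map φ) := by
    refine ⟨?_, ?_, ?_⟩
    · intro e he
      obtain ⟨i, -, rfl⟩ := Finset.mem_map.mp he
      exact hE i
    · simp only [Finset.mem_map, Finset.mem_univ, true_and]
      rintro _ ⟨i, rfl⟩ _ ⟨j, rfl⟩ hij
      exact congrArg φ (hf hij)
    · simp only [Finset.mem_map, Finset.mem_univ, true_and]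
      rintro _ ⟨i, rfl⟩ _ ⟨j, rfl⟩ hij
      exact congrArg φ (hg hij)
  simpa using hM.card_le_matchNum

/-- The submatrix of the generic edge matrix on the vertices of a matching is nonsingular:
it specializes to the identity when the edges of the matching are set to `1` and the other
edges to `0`. -/
theorem IsMatching.det_submatrix_genMat_ne_zero {m n : ℕ} {E M : Finset (Fin m × Fin n)}
    (hM : IsMatching E M) :
    ((genMat E).submatrix (fun e : M => e.1.1) (fun e : M => e.1.2)).det ≠ 0 := by
  let P : Matrix M M (MvPolynomial {e : Fin m × Fin n // e ∈ E} ℚ) :=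
    Matrix.of fun a b =>
      if h : (a.1.1, b.1.2) ∈ E then MvPolynomial.X ⟨(a.1.1, b.1.2), h⟩ else 0
  have hP : (genMat E).submatrix (fun e : M => e.1.1) (fun e : M => e.1.2) =
      (algebraMap _ (EdgeField E)).mapMatrix P := by
    ext a b
    by_cases h : (a.1.1, b.1.2) ∈ E <;> simp [genMat, P, h]
  have heval : (MvPolynomial.eval fun e : {e : Fin m × Fin n // e ∈ E} =>
      if e.1 ∈ M then (1 : ℚ) else 0).mapMatrix P = 1 := by
    ext a b
    by_cases hab : a = b
    · subst hab
      have h : (a.1.1, a.1.2) ∈ E := hM.1 a.2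
      simp [P, h]
    · have h : (a.1.1, b.1.2) ∉ M := fun h =>
        hab (Subtype.ext ((hM.2.1 _ a.2 _ h rfl).trans (hM.2.2 _ h _ b.2 rfl)))
      by_cases hE : (a.1.1, b.1.2) ∈ E <;> simp [P, hE, h, hab]
  rw [hP, ← RingHom.map_det]
  refine (map_ne_zero_iff _ (IsFractionRing.injective _ _)).mpr fun h => ?_
  have := congrArg Matrix.det heval
  rw [← RingHom.map_det, h, map_zero, Matrix.det_one] at this
  exact zero_ne_one this

theorem matchNum_le_rank_genMat {m n : ℕ} (E : Finset (Fin m × Fin n)) :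
    matchNum E ≤ (genMat E).rank := by
  obtain ⟨M, hM, hcard⟩ := exists_isMatching_card_eq_matchNum E
  rw [← hcard, ← Fintype.card_coe, ← Matrix.rank_of_det_ne_zero hM.det_submatrix_genMat_ne_zero]
  exact Matrix.rank_submatrix_le _ _ _

/-- The rank of the generic edge matrix is the matching number. -/
theorem rank_genMat {m n : ℕ} (E : Finset (Fin m × Fin n)) : (genMat E).rank = matchNum E :=
  (rank_genMat_le_matchNum E).antisymm (matchNum_le_rank_genMat E)

/-- Number of massless modes: the dimension of the kernel of the linear map
`x ↦ A_G · x` given by the generic edge matrix equals `n - ν(G)`. -/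
theorem finrank_ker_genMat {n : ℕ} (E : Finset (Fin n × Fin n)) :
    Module.finrank (EdgeField E) ↥(LinearMap.ker (genMat E).mulVecLin)
      = n - matchNum E := by
  have h := (genMat E).mulVecLin.finrank_range_add_finrank_ker
  rw [Module.finrank_fin_fun] at h
  rw [← rank_genMat, Matrix.rank]
  omega
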